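/- Let χ₋₈ : ℕ → ℤ be defined by χ₋₈(n) = 1 if n ≡ 1 or 3 (mod 8), χ₋₈(n) = −1 if n ≡ 5 or 7 (mod 8), and χ₋₈(n) = 0 if n is even. Then Σ_{n=1}^∞ χ₋₈(n)/n² = (√2/16)·π² + Σ_{n=0}^∞ [(1)_n³ (3/4)_n³ / ((3/8)_n³ (7/8)_n³)] · (1/64)^n · (5376n⁴ + 16768n³ + 19296n² + 9660n + 1761) / ((8n+3)³(8n+7)³). -/

import Mathlib

open Real

/-- The Pochhammer symbol (rising factorial): `poch a n = a (a+1) ⋯ (a+n-1)`. -/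
noncomputable def poch (a : ℝ) (n : ℕ) : ℝ := (ascPochhammer ℝ n).eval a

/-- The odd primitive quadratic Dirichlet character modulo 8. -/
def chiNeg8 (n : ℕ) : ℤ :=
  if n % 8 = 1 ∨ n % 8 = 3 then 1 else if n % 8 = 5 ∨ n % 8 = 7 then -1 else 0

/-- `accelBase n a = n! Γ(a + n) / Γ(a + 2n)`, normalised to be `1` at `n = 0`. -/
noncomputable def accelBase : ℕ → ℝ → ℝ
  | 0, _ => 1
  | n + 1, a => accelBase n a * (((n : ℝ) + 1) * (a + n) / ((a + 2 * n) * (a + 2 * n + 1)))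

/-- The numerator of the rational factor in the accelerated series for `∑ (-1)^k / (k + a)^2`. -/
noncomputable def accelNum (x a : ℝ) : ℝ :=
  21 / 2 * x ^ 4 + (17 + 21 * a) * x ^ 3 + (9 + 27 * a + 15 * a ^ 2) * x ^ 2 +
    (3 / 2 + 21 / 2 * a + 27 / 2 * a ^ 2 + 9 / 2 * a ^ 3) * x +
    (a + 3 * a ^ 2 + 2 * a ^ 3 + a ^ 4 / 2)

/-- The summand of the accelerated series for `∑ (-1)^k / (k + a)^2`. -/
noncomputable def accelTerm (a : ℝ) (n : ℕ) : ℝ :=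
  accelBase n a ^ 3 * (accelNum n a / ((a + 2 * n) ^ 3 * (a + 2 * n + 1) ^ 3))

/-- The Wilf–Zeilberger mate of `accelTerm`. -/
noncomputable def accelMate (a : ℝ) (n : ℕ) : ℝ :=
  accelBase n a ^ 3 * ((a + 3 / 2 * n) / (a + 2 * n) ^ 3)

lemma accelBase_nonneg {a : ℝ} (ha : 0 < a) (n : ℕ) : 0 ≤ accelBase n a := by
  induction n with
  | zero => simp [accelBase]
  | succ n ih => rw [accelBase]; positivity

lemma accelBase_add_one {a : ℝ} (ha : 0 < a) (n : ℕ) :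
    accelBase n (a + 1) = accelBase n a * ((a + n) / (a + 2 * n)) := by
  induction n with
  | zero => simp [accelBase, ha.ne']
  | succ n ih =>
    rw [accelBase, accelBase, ih]
    have h1 : a + 2 * n ≠ 0 := by positivity
    have h2 : a + 2 * n + 1 ≠ 0 := by positivity
    have h3 : a + 2 * n + 2 ≠ 0 := by positivity
    have e1 : a + 1 + 2 * (n : ℝ) = a + 2 * n + 1 := by ring
    have e2 : a + 2 * n + 1 + 1 = a + 2 * n + 2 := by ring
    have e3 : a + 2 * ((n : ℝ) + 1) = a + 2 * n + 2 := by ring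
    push_cast
    rw [e1, e2, e3]
    field_simp
    ring

lemma accelBase_pow_three_le {a : ℝ} (ha : 1 / 2 ≤ a) (n : ℕ) :
    accelBase n a ^ 3 ≤ (8 / 27 : ℝ) ^ n := by
  have ha0 : 0 < a := by linarith
  have h : accelBase n a ≤ (2 / 3 : ℝ) ^ n := by
    induction n with
    | zero => simp [accelBase]
    | succ n ih =>
      rw [accelBase, pow_succ]
      refine mul_le_mul ih ?_ (by positivity) (by positivity)
      rw [div_le_div_iff₀ (by positivity) (by norm_num)]
      have hn : (0 : ℝ) ≤ n := n.cast_nonneg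
      nlinarith [mul_nonneg hn hn, mul_nonneg hn ha0.le, mul_nonneg ha0.le (sub_nonneg.2 ha)]
  calc accelBase n a ^ 3 ≤ ((2 / 3 : ℝ) ^ n) ^ 3 :=
        pow_le_pow_left₀ (accelBase_nonneg ha0 n) h 3
    _ = (8 / 27 : ℝ) ^ n := by rw [← pow_mul, mul_comm, pow_mul]; norm_num

lemma accelTerm_add_accelTerm_add_one {a : ℝ} (ha : 0 < a) (n : ℕ) :
    accelTerm a n + accelTerm (a + 1) n = accelMate a n - accelMate a (n + 1) := by
  have h1 : a + 2 * n ≠ 0 := by positivity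
  have h2 : a + 2 * n + 1 ≠ 0 := by positivity
  have h3 : a + 2 * n + 2 ≠ 0 := by positivity
  have e1 : a + 1 + 2 * (n : ℝ) = a + 2 * n + 1 := by ring
  have e2 : a + 2 * n + 1 + 1 = a + 2 * n + 2 := by ring
  have e3 : a + 2 * ((n : ℝ) + 1) = a + 2 * n + 2 := by ring
  rw [accelTerm, accelTerm, accelMate, accelMate, accelBase_add_one ha, accelBase]
  push_cast
  rw [e1, e2, e3]
  simp only [accelNum]
  field_simp
  ring

lemma accelTerm_nonneg {a : ℝ} (ha : 0 < a) (n : ℕ) : 0 ≤ accelTerm a n := by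
  have := accelBase_nonneg ha n
  rw [accelTerm, accelNum]
  positivity

lemma accelTerm_le {a : ℝ} (ha : 1 / 2 ≤ a) (n : ℕ) :
    accelTerm a n ≤ 3 / a ^ 2 * (8 / 27 : ℝ) ^ n := by
  have ha0 : 0 < a := by linarith
  have hn : (0 : ℝ) ≤ n := n.cast_nonneg
  have hnum : accelNum n a ≤ 3 * ((a + 2 * n) * (a + 2 * n + 1) ^ 3) := by
    rw [← sub_nonneg, accelNum]
    ring_nf
    positivity
  have hle : accelNum n a / ((a + 2 * n) ^ 3 * (a + 2 * n + 1) ^ 3) ≤ 3 / a ^ 2 := by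
    rw [div_le_div_iff₀ (by positivity) (by positivity)]
    calc accelNum n a * a ^ 2
        ≤ 3 * ((a + 2 * n) * (a + 2 * n + 1) ^ 3) * (a + 2 * n) ^ 2 := by
          gcongr
          linarith
      _ = 3 * ((a + 2 * n) ^ 3 * (a + 2 * n + 1) ^ 3) := by ring
  rw [accelTerm, mul_comm]
  exact mul_le_mul hle (accelBase_pow_three_le ha n)
    (pow_nonneg (accelBase_nonneg ha0 n) 3) (by positivity)

lemma summable_accelTerm {a : ℝ} (ha : 1 / 2 ≤ a) : Summable (accelTerm a) :=
  .of_nonneg_of_le (accelTerm_nonneg (by linarith)) (accelTerm_le ha)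
    ((summable_geometric_of_lt_one (by norm_num) (by norm_num)).mul_left _)

lemma tendsto_accelMate {a : ℝ} (ha : 1 / 2 ≤ a) :
    Filter.Tendsto (accelMate a) Filter.atTop (nhds 0) := by
  have ha0 : 0 < a := by linarith
  have hlim : Filter.Tendsto (fun n : ℕ => (8 / 27 : ℝ) ^ n * (1 / a ^ 2)) Filter.atTop
      (nhds 0) := by
    simpa only [zero_mul] using (tendsto_pow_atTop_nhds_zero_of_lt_one (r := (8 / 27 : ℝ)) (by norm_num)
      (by norm_num)).mul_const (1 / a ^ 2)
  refine squeeze_zero (fun n => ?_) (fun n => ?_) hlim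
  · have := accelBase_nonneg ha0 n
    rw [accelMate]
    positivity
  · have hn : (0 : ℝ) ≤ n := n.cast_nonneg
    refine mul_le_mul (accelBase_pow_three_le ha n) ?_ (by positivity) (by positivity)
    rw [div_le_div_iff₀ (by positivity) (by positivity), one_mul]
    calc (a + 3 / 2 * n) * a ^ 2 ≤ (a + 2 * n) * (a + 2 * n) ^ 2 := by
          gcongr
          · linarith
          · linarith
      _ = (a + 2 * n) ^ 3 := by ring

lemma tsum_accelTerm_add {a : ℝ} (ha : 1 / 2 ≤ a) :
    ∑' n, accelTerm a n + ∑' n, accelTerm (a + 1) n = 1 / a ^ 2 := by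
  have ha0 : 0 < a := by linarith
  have hs := (summable_accelTerm ha).hasSum.add
    (summable_accelTerm (a := a + 1) (by linarith)).hasSum
  refine tendsto_nhds_unique hs.tendsto_sum_nat ?_
  have h0 : accelMate a 0 = 1 / a ^ 2 := by
    simp [accelMate, accelBase]
    field_simp
  have := (tendsto_accelMate ha).const_sub (accelMate a 0)
  rw [sub_zero, h0] at this
  refine this.congr fun N => ?_
  rw [← h0, ← Finset.sum_range_sub']
  exact Finset.sum_congr rfl fun n _ => (accelTerm_add_accelTerm_add_one ha0 n).symm

lemma tsum_accelTerm_le {a : ℝ} (ha : 1 / 2 ≤ a) :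
    ∑' n, accelTerm a n ≤ 81 / 19 / a ^ 2 := by
  have hg := (hasSum_geometric_of_lt_one (r := (8 / 27 : ℝ)) (by norm_num)
    (by norm_num)).mul_left (3 / a ^ 2)
  refine (hasSum_le (accelTerm_le ha) (summable_accelTerm ha).hasSum hg).trans_eq ?_
  norm_num
  ring

lemma summable_neg_one_pow_div_add_sq {a : ℝ} (ha : 0 < a) :
    Summable fun k : ℕ => (-1 : ℝ) ^ k / ((k : ℝ) + a) ^ 2 := by
  refine .of_norm ?_
  have h := (Real.summable_one_div_nat_add_rpow a 2).2 (by norm_num)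
  refine h.congr fun k => ?_
  have : 0 < (k : ℝ) + a := by positivity
  simp [abs_of_pos this]

/-- Accelerated series for the alternating Hurwitz zeta value at `2`. -/
theorem hasSum_neg_one_pow_div_add_sq {a : ℝ} (ha : 1 / 2 ≤ a) :
    HasSum (fun k : ℕ => (-1 : ℝ) ^ k / ((k : ℝ) + a) ^ 2) (∑' n, accelTerm a n) := by
  have ha0 : 0 < a := by linarith
  have hak (k : ℕ) : 1 / 2 ≤ a + k := by
    have : (0 : ℝ) ≤ k := k.cast_nonneg
    linarith
  have hpart (N : ℕ) : ∑ k ∈ Finset.range N, (-1 : ℝ) ^ k / ((k : ℝ) + a) ^ 2 =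
      ∑' n, accelTerm a n - (-1) ^ N * ∑' n, accelTerm (a + N) n := by
    induction N with
    | zero => simp
    | succ N ih =>
      have h := tsum_accelTerm_add (hak N)
      rw [Finset.sum_range_succ, ih, div_eq_mul_one_div, add_comm (N : ℝ) a, ← h, pow_succ]
      push_cast
      rw [add_assoc a]
      ring
  have hrem : Filter.Tendsto (fun N : ℕ => (-1 : ℝ) ^ N * ∑' n, accelTerm (a + N) n)
      Filter.atTop (nhds 0) := by
    have hlim : Filter.Tendsto (fun N : ℕ => 81 / 19 / (a + (N : ℝ)) ^ 2) Filter.atTop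
        (nhds 0) :=
      ((Filter.tendsto_pow_atTop two_ne_zero).comp
        (Filter.tendsto_atTop_add_const_left _ a tendsto_natCast_atTop_atTop)).const_div_atTop _
    refine squeeze_zero_norm (fun N => ?_) hlim
    rw [norm_mul, norm_pow, norm_neg, norm_one, one_pow, one_mul, Real.norm_of_nonneg
      (tsum_nonneg (accelTerm_nonneg (by linarith [hak N])))]
    exact tsum_accelTerm_le (hak N)
  have hS := (summable_neg_one_pow_div_add_sq ha0).hasSum
  have := tendsto_nhds_unique hS.tendsto_sum_nat
    ((hrem.const_sub (∑' n, accelTerm a n)).congr fun N => (hpart N).symm)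
  rw [sub_zero] at this
  rwa [this] at hS

lemma poch_zero (a : ℝ) : poch a 0 = 1 := by simp [poch]

lemma poch_succ (a : ℝ) (n : ℕ) : poch a (n + 1) = poch a n * (a + n) :=
  ascPochhammer_succ_eval n a

lemma poch_pos {a : ℝ} (ha : 0 < a) (n : ℕ) : 0 < poch a n := ascPochhammer_pos n a ha

lemma accelBase_eq_poch {a : ℝ} (ha : 0 < a) (n : ℕ) :
    accelBase n a = poch 1 n * poch a n / (poch (a / 2) n * poch ((a + 1) / 2) n) *
      (1 / 4) ^ n := by
  induction n with
  | zero => simp [accelBase, poch_zero]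
  | succ n ih =>
    have h1 := (poch_pos (half_pos ha) n).ne'
    have h2 := (poch_pos (a := (a + 1) / 2) (by positivity) n).ne'
    have h3 : a + 2 * n ≠ 0 := by positivity
    have h4 : a + 2 * n + 1 ≠ 0 := by positivity
    have e1 : a / 2 + n = (a + 2 * n) / 2 := by ring
    have e2 : (a + 1) / 2 + n = (a + 2 * n + 1) / 2 := by ring
    rw [accelBase, ih]
    simp only [poch_succ, e1, e2]
    field_simp
    ring

lemma eighth_mul_accelTerm (n : ℕ) :
    1 / 8 * accelTerm (3 / 4) n = (poch 1 n) ^ 3 * (poch (3 / 4) n) ^ 3 /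
            ((poch (3 / 8) n) ^ 3 * (poch (7 / 8) n) ^ 3) *
          (1 / 64 : ℝ) ^ n *
          ((5376 * (n : ℝ) ^ 4 + 16768 * (n : ℝ) ^ 3 + 19296 * (n : ℝ) ^ 2 +
              9660 * (n : ℝ) + 1761) /
            ((8 * (n : ℝ) + 3) ^ 3 * (8 * (n : ℝ) + 7) ^ 3)) := by
  have e1 : (3 / 4 : ℝ) / 2 = 3 / 8 := by norm_num
  have e2 : ((3 / 4 : ℝ) + 1) / 2 = 7 / 8 := by norm_num
  have e3 : (1 / 64 : ℝ) ^ n = ((1 / 4) ^ n) ^ 3 := by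
    rw [← pow_mul, mul_comm, pow_mul]; norm_num
  have e4 : (3 / 4 : ℝ) + 2 * n = (8 * n + 3) / 4 := by ring
  have e5 : (8 * (n : ℝ) + 3) / 4 + 1 = (8 * n + 7) / 4 := by ring
  have h1 : 8 * (n : ℝ) + 3 ≠ 0 := by positivity
  have h2 : 8 * (n : ℝ) + 7 ≠ 0 := by positivity
  have hrat : 1 / 8 * (accelNum n (3 / 4) /
      ((3 / 4 + 2 * n) ^ 3 * (3 / 4 + 2 * n + 1) ^ 3)) =
      (5376 * (n : ℝ) ^ 4 + 16768 * (n : ℝ) ^ 3 + 19296 * (n : ℝ) ^ 2 + 9660 * (n : ℝ) + 1761) /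
        ((8 * (n : ℝ) + 3) ^ 3 * (8 * (n : ℝ) + 7) ^ 3) := by
    rw [accelNum, e4, e5]
    field_simp
    ring
  rw [accelTerm, mul_left_comm, hrat, accelBase_eq_poch (by norm_num), e1, e2, e3, mul_pow,
    div_pow, mul_pow, mul_pow]

/-- The even primitive quadratic Dirichlet character modulo 8. -/
noncomputable def chiPosEight (n : ℕ) : ℝ :=
  if n % 8 = 1 ∨ n % 8 = 7 then 1 else if n % 8 = 3 ∨ n % 8 = 5 then -1 else 0

lemma cos_sub_cos_eq_chiPosEight (n : ℕ) :
    cos (2 * π * n * (1 / 8)) - cos (2 * π * n * (3 / 8)) = √2 * chiPosEight n := by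
  obtain ⟨q, r, hr, rfl⟩ : ∃ q r, r < 8 ∧ n = r + 8 * q :=
    ⟨n / 8, n % 8, Nat.mod_lt _ (by norm_num), (Nat.mod_add_div n 8).symm⟩
  have e1 : 2 * π * ((r + 8 * q : ℕ) : ℝ) * (1 / 8) = r * (π / 4) + q * (2 * π) := by
    push_cast; ring
  have e2 : 2 * π * ((r + 8 * q : ℕ) : ℝ) * (3 / 8) =
      3 * (r * (π / 4)) + (3 * q : ℕ) * (2 * π) := by
    push_cast; ring
  rw [e1, e2, cos_add_nat_mul_two_pi, cos_add_nat_mul_two_pi, cos_three_mul, chiPosEight,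
    Nat.add_mul_mod_self_left]
  have hs : √2 ^ 2 = 2 := sq_sqrt (by norm_num)
  have hs3 : √2 ^ 3 = 2 * √2 := by rw [pow_succ, hs]
  have c1 := cos_pi_div_four
  have c2 : cos (2 * (π / 4)) = 0 := by rw [← cos_pi_div_two]; congr 1; ring
  have c3 : cos (3 * (π / 4)) = -(√2 / 2) := by
    rw [← cos_pi_div_four, ← cos_pi_sub]; congr 1; ring
  have c4 : cos (4 * (π / 4)) = -1 := by rw [← cos_pi]; congr 1; ring
  have c5 : cos (5 * (π / 4)) = -(√2 / 2) := by
    rw [← cos_pi_div_four, ← cos_add_pi]; congr 1; ring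
  have c6 : cos (6 * (π / 4)) = 0 := by
    rw [← neg_zero, ← cos_pi_div_two, ← cos_add_pi]; congr 1; ring
  have c7 : cos (7 * (π / 4)) = √2 / 2 := by
    rw [← cos_pi_div_four, ← cos_two_pi_sub]; congr 1; ring
  interval_cases r <;> norm_num [c1, c2, c3, c4, c5, c6, c7] <;> ring_nf <;>
    (try rw [hs3]) <;> ring

lemma hasSum_chiPosEight_div_sq :
    HasSum (fun n : ℕ => chiPosEight n / (n : ℝ) ^ 2) (√2 / 16 * π ^ 2) := by
  have h1 := hasSum_one_div_nat_pow_mul_cos one_ne_zero (x := 1 / 8) (by norm_num)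
  have h3 := hasSum_one_div_nat_pow_mul_cos one_ne_zero (x := 3 / 8) (by norm_num)
  have hs : √2 ^ 2 = 2 := sq_sqrt (by norm_num)
  convert! (h1.sub h3).mul_left (1 / √2) using 1
  · ext n
    rw [← mul_sub, cos_sub_cos_eq_chiPosEight, mul_one]
    field_simp
  · have hB (x : ℝ) : ((Polynomial.bernoulli (2 * 1)).map (algebraMap ℚ ℝ)).eval x =
        x ^ 2 - x + 1 / 6 := by
      simp [Polynomial.bernoulli, Finset.sum_range_succ, Polynomial.eval_add, bernoulli]
      ring
    rw [hB, hB]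
    norm_num [Nat.factorial]
    field_simp
    rw [hs]
    ring

lemma hasSum_chiNeg8_sub_chiPosEight_div_sq :
    HasSum (fun n : ℕ => ((chiNeg8 n : ℝ) - chiPosEight n) / (n : ℝ) ^ 2)
      (1 / 8 * ∑' n, accelTerm (3 / 4) n) := by
  have h := (hasSum_neg_one_pow_div_add_sq (a := 3 / 4) (by norm_num)).mul_left (1 / 8)
  have hinj : Function.Injective fun k : ℕ => 4 * k + 3 := fun a b hab => by
    simp only at hab; omega
  rw [← hinj.hasSum_iff]
  · refine h.congr_fun fun k => ?_
    have hchi : (chiNeg8 (4 * k + 3) : ℝ) - chiPosEight (4 * k + 3) = 2 * (-1) ^ k := by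
      unfold chiNeg8 chiPosEight
      rcases k.even_or_odd' with ⟨m, rfl | rfl⟩
      · have : (4 * (2 * m) + 3) % 8 = 3 := by omega
        norm_num [this, pow_mul]
      · have : (4 * (2 * m + 1) + 3) % 8 = 7 := by omega
        norm_num [this, pow_succ, pow_mul]
    have hk : (k : ℝ) + 3 / 4 = (4 * k + 3) / 4 := by ring
    have hk0 : 4 * (k : ℝ) + 3 ≠ 0 := by positivity
    simp only [Function.comp_apply, hchi, hk]
    push_cast
    field_simp
    norm_num
  · intro n hn
    have h3 : n % 4 ≠ 3 := fun h => hn ⟨n / 4, by simp only; omega⟩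
    have hd : (chiNeg8 n : ℝ) - chiPosEight n = 0 := by
      have : n % 8 < 8 := Nat.mod_lt _ (by norm_num)
      unfold chiNeg8 chiPosEight
      generalize hr : n % 8 = r at *
      have h4 : r % 4 ≠ 3 := by omega
      interval_cases r <;> simp_all
    rw [hd, zero_div]

theorem L_neg8_two_fast_series :
    ∑' n : ℕ, (chiNeg8 (n + 1) : ℝ) / ((n : ℝ) + 1) ^ 2 =
      Real.sqrt 2 / 16 * π ^ 2 +
        ∑' n : ℕ, (poch 1 n) ^ 3 * (poch (3 / 4) n) ^ 3 /
            ((poch (3 / 8) n) ^ 3 * (poch (7 / 8) n) ^ 3) *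
          (1 / 64 : ℝ) ^ n *
          ((5376 * (n : ℝ) ^ 4 + 16768 * (n : ℝ) ^ 3 + 19296 * (n : ℝ) ^ 2 +
              9660 * (n : ℝ) + 1761) /
            ((8 * (n : ℝ) + 3) ^ 3 * (8 * (n : ℝ) + 7) ^ 3)) := by
  have h := hasSum_chiNeg8_sub_chiPosEight_div_sq.add hasSum_chiPosEight_div_sq
  simp only [← add_div, sub_add_cancel] at h
  have h0 := (hasSum_nat_add_iff' 1).2 h
  simp only [Nat.cast_add, Nat.cast_one, Finset.sum_range_one, Nat.cast_zero, ne_eq,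
    OfNat.ofNat_ne_zero, not_false_eq_true, zero_pow, div_zero, sub_zero] at h0
  rw [h0.tsum_eq, add_comm, ← tsum_mul_left]
  simp only [eighth_mul_accelTerm]
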